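/- Let r ≥ 1 and let μ = (μ_1, …, μ_r) be a probability vector with μ_i > 0 for all i. Consider sequences of integers with 1 ≤ K_{1,n} ≤ K_{2,n} ≤ … ≤ K_{r,n} ≤ P_n/2 for all n, and define p_{ij}(n) = 1 − C(P_n − K_{i,n}, K_{j,n})/C(P_n, K_{j,n}) and λ_1(n) = Σ_{j=1}^r μ_j p_{1j}(n), where C(a,b) denotes the binomial coefficient. If λ_1(n) → 0 as n → ∞, then λ_1(n) is asymptotically equivalent to K_{1,n} · K_{avg,n} / P_n, where K_{avg,n} = Σ_{j=1}^r μ_j K_{j,n}; that is, λ_1(n) · P_n / (K_{1,n} · K_{avg,n}) → 1 as n → ∞. -/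

import Mathlib

open Filter Real

noncomputable section

namespace HetKey

/-- The set of ordered index pairs `x < y` (one Bernoulli coin per unordered pair). -/
abbrev Pairs (n : ℕ) : Type := {p : Fin n × Fin n // p.1 < p.2}

/-- A configuration of the randomness: the class of each vertex, the key ring of each
vertex (a subset of the key pool `{1,…,P}`), and the Bernoulli link coins. -/
abbrev Config (n r P : ℕ) : Type :=
  (Fin n → Fin r) × (Fin n → Finset (Fin P)) × (Pairs n → Bool)

/-- Weight of a key ring under the uniform distribution on `k`-subsets of the pool. -/
def keyWeight (P k : ℕ) (s : Finset (Fin P)) : ℝ :=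
  if s.card = k then ((P.choose k : ℝ))⁻¹ else 0

/-- Probability weight of a configuration: classes are i.i.d. with law `μ`, key rings are
(conditionally) uniform `K (class)`-subsets, link coins are i.i.d. Bernoulli(`α`). -/
def weight {n r P : ℕ} (μ : Fin r → ℝ) (K : Fin r → ℕ) (α : ℝ)
    (cfg : Config n r P) : ℝ :=
  (∏ x, μ (cfg.1 x) * keyWeight P (K (cfg.1 x)) (cfg.2.1 x)) *
    ∏ p, (if cfg.2.2 p then α else 1 - α)

open scoped Classical in
/-- Probability of an event in `G(n; μ, K, P, α)`. -/
def Pr {n r P : ℕ} (μ : Fin r → ℝ) (K : Fin r → ℕ) (α : ℝ)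
    (E : Config n r P → Prop) : ℝ :=
  ∑ cfg, if E cfg then weight μ K α cfg else 0

/-- Expectation of a random variable on the configuration space. -/
def expect {n r P : ℕ} (μ : Fin r → ℝ) (K : Fin r → ℕ) (α : ℝ)
    (X : Config n r P → ℝ) : ℝ :=
  ∑ cfg, weight μ K α cfg * X cfg

/-- The Bernoulli coin attached to the unordered pair `{x, y}`. -/
def coin {n : ℕ} (b : Pairs n → Bool) (x y : Fin n) : Bool :=
  if h : x < y then b ⟨(x, y), h⟩
  else if h' : y < x then b ⟨(y, x), h'⟩
  else false

/-- Adjacency in `G(n; μ, K, P, α)`: distinct vertices, intersecting key rings, and an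
operational (non-failed) link. -/
def adj {n r P : ℕ} (cfg : Config n r P) (x y : Fin n) : Prop :=
  x ≠ y ∧ (cfg.2.1 x ∩ cfg.2.1 y).Nonempty ∧ coin cfg.2.2 x y = true

/-- A vertex is isolated if it has no neighbours. -/
def isolated {n r P : ℕ} (cfg : Config n r P) (x : Fin n) : Prop :=
  ∀ y, ¬ adj cfg x y

/-- Connectivity: every pair of vertices is joined by a path. -/
def conn {n r P : ℕ} (cfg : Config n r P) : Prop :=
  ∀ x y : Fin n, Relation.ReflTransGen (adj cfg) x y

/-- `p_{ij}`: the probability that a uniform `K_i`-subset and an independent uniform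
`K_j`-subset of a pool of size `P` intersect. -/
def pEdge (P Ki Kj : ℕ) : ℝ :=
  1 - ((P - Ki).choose Kj : ℝ) / (P.choose Kj : ℝ)

/-- `λ_i = Σ_j μ_j p_{ij}`. -/
def lam {r : ℕ} (μ : Fin r → ℝ) (K : Fin r → ℕ) (P : ℕ) (i : Fin r) : ℝ :=
  ∑ j, μ j * pEdge P (K i) (K j)

/-- `Λ_i = α λ_i`. -/
def Lam {r : ℕ} (μ : Fin r → ℝ) (K : Fin r → ℕ) (P : ℕ) (α : ℝ) (i : Fin r) : ℝ :=
  α * lam μ K P i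

end HetKey

open HetKey

namespace HetKey

/-- Enlarging the first key ring by one key multiplies the probability of avoiding the second
ring by `1 - b / (P - a)`. -/
lemma one_sub_pEdge_succ {P a b : ℕ} (h : a + 1 + b ≤ P) :
    (1 - pEdge P (a + 1) b) * ((P : ℝ) - a) = (1 - pEdge P a b) * ((P : ℝ) - a - b) := by
  obtain ⟨m, rfl⟩ := Nat.exists_eq_add_of_le h
  have hc := Nat.choose_mul_succ_eq (b + m) b
  have e1 : a + 1 + b + m - (a + 1) = b + m := by omega
  have e2 : a + 1 + b + m - a = b + m + 1 := by omega
  have e3 : b + m + 1 - b = m + 1 := by omega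
  rw [e3] at hc
  have hc' : ((b + m).choose b : ℝ) * (b + m + 1) = ((b + m + 1).choose b : ℝ) * (m + 1) := by
    exact_mod_cast hc
  simp only [pEdge, e1, e2, sub_sub_cancel]
  push_cast
  rw [div_mul_eq_mul_div, div_mul_eq_mul_div]
  congr 1
  linear_combination hc'

lemma one_sub_pEdge_nonneg (P a b : ℕ) : 0 ≤ 1 - pEdge P a b := by
  simp only [pEdge, sub_sub_cancel]
  positivity

lemma pEdge_nonneg (P a b : ℕ) : 0 ≤ pEdge P a b := by
  have h : ((P - a).choose b : ℝ) ≤ (P.choose b : ℝ) := by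
    exact_mod_cast Nat.choose_le_choose b (Nat.sub_le P a)
  exact sub_nonneg.2 (div_le_one_of_le₀ h (Nat.cast_nonneg _))

lemma pEdge_zero_left {P b : ℕ} (h : b ≤ P) : pEdge P 0 b = 0 := by
  have : (P.choose b : ℝ) ≠ 0 := by exact_mod_cast (Nat.choose_pos h).ne'
  simp [pEdge, this]

/-- Union bound for the intersection probability. -/
lemma pEdge_mul_le {P a b : ℕ} (h : a + b ≤ P) :
    pEdge P a b * ((P : ℝ) - a) ≤ a * b := by
  induction a with
  | zero => simp [pEdge_zero_left (by omega : b ≤ P)]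
  | succ a ih =>
    have hs := one_sub_pEdge_succ h
    have h0 := pEdge_nonneg P a b
    have h1 := pEdge_nonneg P (a + 1) b
    have hb : (0 : ℝ) ≤ b := Nat.cast_nonneg b
    push_cast
    nlinarith [ih (by omega), mul_nonneg h0 hb]

/-- Bonferroni-type lower bound for the intersection probability. -/
lemma one_sub_pEdge_mul_le_one {P a b : ℕ} (h : a + b ≤ P) (hP : 0 < P) :
    (1 - pEdge P a b) * (1 + (a : ℝ) * b / P) ≤ 1 := by
  induction a with
  | zero => simp [pEdge_zero_left (by omega : b ≤ P)]
  | succ a ih =>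
    have hs := one_sub_pEdge_succ h
    have hq := one_sub_pEdge_nonneg P a b
    have hP' : (0 : ℝ) < P := by exact_mod_cast hP
    have hPa : (0 : ℝ) < (P : ℝ) - a := by
      have : a + 1 ≤ P := by omega
      have : (a : ℝ) + 1 ≤ P := by exact_mod_cast this
      linarith
    have hstep : 1 - pEdge P (a + 1) b ≤ (1 - pEdge P a b) * (1 - (b : ℝ) / P) := by
      have hdiv : (b : ℝ) / P ≤ b / ((P : ℝ) - a) := by
        gcongr
        linarith [(Nat.cast_nonneg a : (0 : ℝ) ≤ a)]
      have heq : 1 - pEdge P (a + 1) b = (1 - pEdge P a b) * (1 - b / ((P : ℝ) - a)) := by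
        field_simp
        linear_combination hs
      rw [heq]
      gcongr
    have hx : (0 : ℝ) ≤ (b : ℝ) / P := by positivity
    have ih' := ih (by omega)
    rw [mul_div_assoc] at ih' ⊢
    push_cast
    set x : ℝ := (b : ℝ) / P
    have ha : (0 : ℝ) ≤ a := Nat.cast_nonneg a
    calc (1 - pEdge P (a + 1) b) * (1 + ((a : ℝ) + 1) * x)
        ≤ ((1 - pEdge P a b) * (1 - x)) * (1 + ((a : ℝ) + 1) * x) := by gcongr
      _ ≤ (1 - pEdge P a b) * (1 + a * x) := by
        nlinarith [mul_nonneg hq (mul_nonneg (by linarith : (0 : ℝ) ≤ a + 1) (sq_nonneg x))]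
      _ ≤ 1 := ih'

/-- Vanishing intersection probabilities are asymptotic to `a b / P`. -/
lemma tendsto_pEdge_div {a b P : ℕ → ℕ} (ha : ∀ n, 1 ≤ a n) (hb : ∀ n, 1 ≤ b n)
    (hab : ∀ n, a n + b n ≤ P n)
    (hp : Tendsto (fun n => pEdge (P n) (a n) (b n)) atTop (nhds 0)) :
    Tendsto (fun n => pEdge (P n) (a n) (b n) / ((a n : ℝ) * b n / P n)) atTop (nhds 1) := by
  have hP (n) : 0 < P n := by have := ha n; have := hab n; omega
  have hP' (n) : (0 : ℝ) < P n := by exact_mod_cast hP n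
  have ha' (n) : (1 : ℝ) ≤ a n := by exact_mod_cast ha n
  have hb' (n) : (1 : ℝ) ≤ b n := by exact_mod_cast hb n
  have hxpos (n) : 0 < (a n : ℝ) * b n / P n := by
    have := ha' n; have := hb' n; have := hP' n; positivity
  have hlow (n) := one_sub_pEdge_mul_le_one (hab n) (hP n)
  have hx : Tendsto (fun n => (a n : ℝ) * b n / P n) atTop (nhds 0) := by
    refine squeeze_zero' (g := fun n => 1 / (1 - pEdge (P n) (a n) (b n)) - 1)
      (.of_forall fun n => (hxpos n).le) ?_ ?_
    · filter_upwards [hp.eventually_lt_const one_pos] with n hn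
      have := (le_div_iff₀' (sub_pos.2 hn)).2 (hlow n)
      linarith
    · simpa using ((tendsto_const_nhds (x := (1 : ℝ))).div (hp.const_sub 1) (by norm_num)).sub_const 1
  have hy : Tendsto (fun n => (a n : ℝ) / P n) atTop (nhds 0) := by
    refine squeeze_zero (fun n => by positivity) (fun n => ?_) hx
    have := hP' n
    gcongr
    nlinarith [ha' n, hb' n]
  refine tendsto_of_tendsto_of_tendsto_of_le_of_le
    (g := fun n => 1 / (1 + (a n : ℝ) * b n / P n)) (h := fun n => 1 / (1 - (a n : ℝ) / P n))
    ?_ ?_ (fun n => ?_) (fun n => ?_)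
  · simpa using (hx.const_add 1).inv₀ (by norm_num)
  · simpa using (hy.const_sub 1).inv₀ (by norm_num)
  · have := hxpos n
    beta_reduce
    rw [div_le_div_iff₀ (by linarith) this]
    linarith [hlow n]
  · have hPa : (0 : ℝ) < (P n : ℝ) - a n := by
      have : (a n : ℝ) + b n ≤ P n := by exact_mod_cast hab n
      linarith [hb' n]
    have hP'' := hP' n
    have hpos : 0 < 1 - (a n : ℝ) / P n := by
      rw [one_sub_div hP''.ne']; positivity
    beta_reduce
    rw [div_le_div_iff₀ (hxpos n) hpos, one_sub_div hP''.ne', mul_div_assoc', one_mul]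
    exact div_le_div_of_nonneg_right (pEdge_mul_le (hab n)) hP''.le

end HetKey


/-- if `λ_1(n) → 0`, then `λ_1(n) ∼ K_{1,n} K_{avg,n} / P_n`, i.e.
`λ_1(n) P_n / (K_{1,n} K_{avg,n}) → 1`, where `K_{avg,n} = Σ_j μ_j K_{j,n}`. -/
theorem lam_one_asymptotic_equivalence
    (r : ℕ) (hr : 0 < r)
    (μ : Fin r → ℝ) (hμpos : ∀ i, 0 < μ i) (hμsum : ∑ i, μ i = 1)
    (K : ℕ → Fin r → ℕ) (Pn : ℕ → ℕ)
    (hK1 : ∀ n i, 1 ≤ K n i)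
    (hKmono : ∀ n, Monotone (K n))
    (hKP : ∀ n i, 2 * K n i ≤ Pn n)
    (hlam0 : Tendsto (fun n => lam μ (K n) (Pn n) ⟨0, hr⟩) atTop (nhds 0)) :
    Tendsto
      (fun n => lam μ (K n) (Pn n) ⟨0, hr⟩ * (Pn n : ℝ) /
        ((K n ⟨0, hr⟩ : ℝ) * ∑ j, μ j * (K n j : ℝ)))
      atTop (nhds 1) := by
  have hp (j : Fin r) :
      Tendsto (fun n => pEdge (Pn n) (K n ⟨0, hr⟩) (K n j)) atTop (nhds 0) := by
    refine squeeze_zero (fun n => pEdge_nonneg _ _ _) (fun n => ?_)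
      (by simpa using hlam0.div_const (μ j))
    rw [le_div_iff₀' (hμpos j)]
    exact Finset.single_le_sum (f := fun j => μ j * pEdge (Pn n) (K n ⟨0, hr⟩) (K n j))
      (fun i _ => mul_nonneg (hμpos i).le (pEdge_nonneg _ _ _)) (Finset.mem_univ j)
  have hP (n) : (0 : ℝ) < Pn n := by
    have := hK1 n ⟨0, hr⟩
    have := hKP n ⟨0, hr⟩
    exact_mod_cast (by omega : 0 < Pn n)
  have hK (n i) : (0 : ℝ) < K n i := by exact_mod_cast hK1 n i
  have hxpos (n j) : 0 < (K n ⟨0, hr⟩ : ℝ) * K n j / Pn n := by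
    have := hP n; have := hK n j; have := hK n ⟨0, hr⟩; positivity
  have hequiv (j : Fin r) := tendsto_pEdge_div (fun n => hK1 n ⟨0, hr⟩) (fun n => hK1 n j)
    (fun n => by have := hKP n ⟨0, hr⟩; have := hKP n j; omega) (hp j)
  have hsum (n) : 0 < ∑ j, μ j * ((K n ⟨0, hr⟩ : ℝ) * K n j / Pn n) :=
    Finset.sum_pos (fun j _ => mul_pos (hμpos j) (hxpos n j)) ⟨⟨0, hr⟩, Finset.mem_univ _⟩
  have hlittle : (fun n => ∑ j, (μ j * pEdge (Pn n) (K n ⟨0, hr⟩) (K n j) -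
        μ j * ((K n ⟨0, hr⟩ : ℝ) * K n j / Pn n))) =o[atTop]
      fun n => ∑ j, μ j * ((K n ⟨0, hr⟩ : ℝ) * K n j / Pn n) := by
    refine Asymptotics.IsLittleO.fun_sum fun j _ => ?_
    have h := (Asymptotics.isEquivalent_of_tendsto_one
      (u := fun n => pEdge (Pn n) (K n ⟨0, hr⟩) (K n j))
      (v := fun n => (K n ⟨0, hr⟩ : ℝ) * K n j / Pn n) (hequiv j)).isLittleO.const_mul_left (μ j)
    simp only [Pi.sub_apply, mul_sub] at h
    refine h.trans_isBigO ?_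
    refine Asymptotics.IsBigO.of_bound (μ j)⁻¹ (.of_forall fun n => ?_)
    rw [Real.norm_of_nonneg (hxpos n j).le, Real.norm_of_nonneg (hsum n).le,
      le_inv_mul_iff₀ (hμpos j)]
    exact Finset.single_le_sum (f := fun j => μ j * ((K n ⟨0, hr⟩ : ℝ) * K n j / Pn n))
      (fun i _ => (mul_pos (hμpos i) (hxpos n i)).le) (Finset.mem_univ j)
  have hmain : Asymptotics.IsEquivalent atTop (fun n => lam μ (K n) (Pn n) ⟨0, hr⟩)
      fun n => ∑ j, μ j * ((K n ⟨0, hr⟩ : ℝ) * K n j / Pn n) := by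
    refine Asymptotics.IsLittleO.isEquivalent ?_
    simp only [Finset.sum_sub_distrib] at hlittle
    exact hlittle
  refine ((Asymptotics.isEquivalent_iff_tendsto_one
    (.of_forall fun n => (hsum n).ne')).1 hmain).congr fun n => ?_
  have hfactor : ∑ j, μ j * ((K n ⟨0, hr⟩ : ℝ) * K n j / Pn n) =
      (K n ⟨0, hr⟩ : ℝ) * (∑ j, μ j * (K n j : ℝ)) / Pn n := by
    rw [Finset.mul_sum, Finset.sum_div]
    exact Finset.sum_congr rfl fun j _ => by ring
  rw [Pi.div_apply, hfactor, div_div_eq_mul_div]
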